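/- arXiv:2102.10070 — 2 statements merged into one kernel-verified Lean document; each statement's English description precedes it below -/
import Mathlib

section
/- Let G be a minimal transitive permutation group on a finite set Ω, let L be a minimal normal subgroup of G, and let ω ∈ Ω. Then there is no subgroup S of G with 1 < S < L (S nontrivial and a proper subgroup of L) satisfying both: (a) the S-orbit of ω equals the L-orbit of ω; and (b) for every g ∈ G there exists l ∈ L with g⁻¹Sg = l⁻¹Sl. -/
/-- Let `G` be a minimal transitive permutation group on a finite set `Ω`, `L` a minimal
normal subgroup of `G`, and `ω ∈ Ω`. Then there is no subgroup `1 < S < L` such that the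
`S`-orbit of `ω` equals the `L`-orbit of `ω` and every `G`-conjugate of `S` is an
`L`-conjugate of `S`. -/
theorem minimal_transitive_no_frattini_seed_inside_minimal_normal
    {Ω : Type*} [Fintype Ω] (G : Subgroup (Equiv.Perm Ω))
    (htrans : MulAction.IsPretransitive G Ω)
    (hmin : ∀ H : Subgroup (Equiv.Perm Ω), H < G → ¬ MulAction.IsPretransitive H Ω)
    (L : Subgroup G) (hLnormal : L.Normal) (hLbot : L ≠ ⊥)
    (hLmin : ∀ L' : Subgroup G, L'.Normal → L' ≠ ⊥ → L' ≤ L → L' = L)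
    (ω : Ω) :
    ¬ ∃ S : Subgroup G, ⊥ < S ∧ S < L ∧
      MulAction.orbit S ω = MulAction.orbit L ω ∧
      (∀ g : G, ∃ l ∈ L,
        S.map (MulAut.conj g⁻¹).toMonoidHom = S.map (MulAut.conj l⁻¹).toMonoidHom) := by
  rintro ⟨S, hSbot, hSL, horb, hconj⟩
  have hfactor : ∀ g : G, ∃ l ∈ L, g * l⁻¹ ∈ Subgroup.normalizer (S : Set G) := by
    intro g
    obtain ⟨l, hl, h⟩ := hconj g
    refine ⟨l, hl, ?_⟩
    rw [← inv_mem_iff, Subgroup.mem_normalizer_iff]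
    intro x
    have hx : (g⁻¹ * x * g ∈ S.map (MulAut.conj g⁻¹).toMonoidHom) ↔
        (g⁻¹ * x * g ∈ S.map (MulAut.conj l⁻¹).toMonoidHom) := by rw [h]
    rw [Subgroup.mem_map_equiv, Subgroup.mem_map_equiv] at hx
    simpa [MulAut.conj_symm_apply, mul_assoc] using hx
  have hbase : ∀ x : Ω, ∃ n ∈ Subgroup.normalizer (S : Set G), n • ω = x := by
    intro x
    obtain ⟨g, rfl⟩ := htrans.exists_smul_eq ω x
    obtain ⟨l, hl, hn⟩ := hfactor g
    have hlω : l • ω ∈ MulAction.orbit S ω := by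
      rw [horb]
      exact ⟨⟨l, hl⟩, rfl⟩
    obtain ⟨s, hs⟩ := hlω
    refine ⟨g * l⁻¹ * s, mul_mem hn (Subgroup.le_normalizer s.2), ?_⟩
    have hs' : (s : G) • ω = l • ω := hs
    rw [mul_smul, hs', ← mul_smul, inv_mul_cancel_right]
  have htop : Subgroup.normalizer (S : Set G) = ⊤ := by
    by_contra hne
    refine hmin ((Subgroup.normalizer (S : Set G)).map G.subtype) ?_ ⟨fun x y => ?_⟩
    · refine lt_of_le_of_ne (Subgroup.map_subtype_le _) fun heq => hne ?_
      apply Subgroup.map_injective G.subtype_injective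
      rw [heq, ← MonoidHom.range_eq_map, Subgroup.range_subtype]
    · obtain ⟨n, hn, rfl⟩ := hbase x
      obtain ⟨m, hm, rfl⟩ := hbase y
      refine ⟨⟨G.subtype (m * n⁻¹),
        Subgroup.mem_map_of_mem _ (mul_mem hm (inv_mem hn))⟩, ?_⟩
      change (m * n⁻¹) • n • ω = m • ω
      rw [← mul_smul, inv_mul_cancel_right]
  exact hSL.ne (hLmin S (Subgroup.normalizer_eq_top_iff.mp htop) hSbot.ne' hSL.le)
end

section
/- Let G be a minimal transitive permutation group on a finite set Ω, let L be a minimal normal subgroup of G, and let K = {g ∈ G : for every ω ∈ Ω, g·ω lies in the L-orbit of ω} be the kernel of the induced action of G on the set of L-orbits. Then L ≤ K and the quotient group K/L is soluble. -/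
/-- If every element of `K` preserves each orbit of the subgroup `H`, and `H` and `K` together
generate a transitive group, then `H` is transitive. -/
theorem MulAction.isPretransitive_of_sup_eq_top {G Ω : Type*} [Group G] [MulAction G Ω]
    [MulAction.IsPretransitive G Ω] {H K : Subgroup G} (hHK : H ⊔ K = ⊤)
    (hK : ∀ k ∈ K, ∀ ω : Ω, k • ω ∈ MulAction.orbit H ω) :
    MulAction.IsPretransitive H Ω := by
  have key : ∀ g : G, ∀ ω : Ω, g • ω ∈ MulAction.orbit H ω := by
    intro g
    have hg : g ∈ Subgroup.closure ((H : Set G) ∪ K) := by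
      rw [← Subgroup.sup_eq_closure, hHK]
      exact Subgroup.mem_top g
    induction hg using Subgroup.closure_induction with
    | mem x hx =>
      intro ω
      rcases hx with hx | hx
      · exact ⟨⟨x, hx⟩, rfl⟩
      · exact hK x hx ω
    | one => simp
    | mul x y _ _ ihx ihy =>
      intro ω
      rw [mul_smul, ← MulAction.orbit_eq_iff.mpr (ihy ω)]
      exact ihx (y • ω)
    | inv x _ ih =>
      intro ω
      rw [MulAction.mem_orbit_symm]
      simpa using ih (x⁻¹ • ω)
  refine ⟨fun a b => ?_⟩
  obtain ⟨g, rfl⟩ := MulAction.exists_smul_eq G a b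
  exact key g a

/-- In a minimal transitive group, the elements preserving every orbit of a normal subgroup `L`
map into the Frattini subgroup of the quotient by `L`. -/
theorem MulAction.map_mk'_le_frattini {G Ω : Type*} [Group G] [MulAction G Ω]
    [MulAction.IsPretransitive G Ω]
    (hmin : ∀ H : Subgroup G, MulAction.IsPretransitive H Ω → H = ⊤)
    (L : Subgroup G) [L.Normal] {K : Subgroup G}
    (hK : ∀ k ∈ K, ∀ ω : Ω, k • ω ∈ MulAction.orbit L ω) :
    K.map (QuotientGroup.mk' L) ≤ frattini (G ⧸ L) := by
  refine le_iInf₂ fun M hM => ?_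
  rw [Subgroup.map_le_iff_le_comap]
  have hcoatom : IsCoatom (M.comap (QuotientGroup.mk' L)) :=
    Subgroup.isCoatom_comap_of_surjective (QuotientGroup.mk'_surjective L) hM
  by_contra hle
  have hsup : M.comap (QuotientGroup.mk' L) ⊔ K = ⊤ :=
    hcoatom.2 _ (left_lt_sup.mpr hle)
  refine hcoatom.1 (hmin _ (MulAction.isPretransitive_of_sup_eq_top hsup fun k hk ω => ?_))
  obtain ⟨l, hl⟩ := hK k hk ω
  exact ⟨⟨l, QuotientGroup.le_comap_mk' L M l.2⟩, hl⟩

/-- If the image of `K` in the finite group `G ⧸ L` lies in the Frattini subgroup, then `K / L`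
is soluble. -/
theorem isSolvable_quotient_subgroupOf_of_map_le_frattini {G : Type*} [Group G] [Finite G]
    (L K : Subgroup G) [L.Normal] (h : K.map (QuotientGroup.mk' L) ≤ frattini (G ⧸ L)) :
    Group.IsSolvable (K ⧸ L.subgroupOf K) := by
  have hnil : Group.IsNilpotent (frattini (G ⧸ L)) := frattini_nilpotent
  let f : K →* frattini (G ⧸ L) :=
    ((QuotientGroup.mk' L).comp K.subtype).codRestrict _ fun k =>
      h (Subgroup.mem_map_of_mem _ k.2)
  have hker : f.ker = L.subgroupOf K := by
    ext k
    simp [f, MonoidHom.ker_codRestrict, Subgroup.mem_subgroupOf]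
  have hsolv : Group.IsSolvable (K ⧸ f.ker) :=
    Group.isSolvable_of_isSolvable_injective (QuotientGroup.kerLift_injective f)
  exact Group.isSolvable_of_surjective
    (f := (QuotientGroup.quotientMulEquivOfEq hker).toMonoidHom)
    (QuotientGroup.quotientMulEquivOfEq hker).surjective

/-- Let `G` be a minimal transitive permutation group on a finite set `Ω`, `L` a minimal
normal subgroup of `G`, and `K` the kernel of the action of `G` on the set of `L`-orbits.
Then `L ≤ K` and `K/L` is soluble. -/
theorem minimal_transitive_kernel_over_minimal_normal_is_soluble
    {Ω : Type*} [Fintype Ω] (G : Subgroup (Equiv.Perm Ω))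
    (htrans : MulAction.IsPretransitive G Ω)
    (hmin : ∀ H : Subgroup (Equiv.Perm Ω), H < G → ¬ MulAction.IsPretransitive H Ω)
    (L : Subgroup G) [hLnormal : L.Normal] (hLbot : L ≠ ⊥)
    (hLmin : ∀ L' : Subgroup G, L'.Normal → L' ≠ ⊥ → L' ≤ L → L' = L)
    (K : Subgroup G)
    (hK : ∀ g : G, g ∈ K ↔ ∀ ω : Ω, g • ω ∈ MulAction.orbit L ω) :
    L ≤ K ∧ IsSolvable (K ⧸ L.subgroupOf K) := by
  have hmin' : ∀ H : Subgroup G, MulAction.IsPretransitive H Ω → H = ⊤ := by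
    intro H hH
    by_contra hne
    refine hmin (H.map G.subtype) ?_ ⟨fun a b => ?_⟩
    · refine lt_of_le_of_ne (Subgroup.map_subtype_le H) fun heq => hne ?_
      apply Subgroup.map_injective G.subtype_injective
      rw [heq, ← MonoidHom.range_eq_map, Subgroup.range_subtype]
    · obtain ⟨h, rfl⟩ := MulAction.exists_smul_eq H a b
      exact ⟨⟨_, Subgroup.mem_map_of_mem G.subtype h.2⟩, rfl⟩
  refine ⟨fun l hl => (hK l).mpr fun ω => ⟨⟨l, hl⟩, rfl⟩, ?_⟩
  exact isSolvable_quotient_subgroupOf_of_map_le_frattini L K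
    (MulAction.map_mk'_le_frattini hmin' L fun k hk => (hK k).mp hk)
end
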